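/- arXiv:2111.02192 — 3 statements merged into one kernel-verified Lean document; each statement's English description precedes it below -/
import Mathlib

section
/- Let r ≥ 1, let S ⊆ ℤ^r be finite and let a : S → ℂ. Assume that Z(p_a) contains no coset of a one-dimensional subtorus. Then every holomorphic map f = (f_1, …, f_r) : ℂ → ℂ^r such that f_i(ζ) ≠ 0 for all ζ ∈ ℂ and all i, and p_a(f(ζ)) = 0 for all ζ ∈ ℂ, is constant. -/
open scoped BigOperators

noncomputable section

/-- The Laurent monomial `z^I = ∏ i, z i ^ (I i)` with integer exponents. -/
def lmon {r : ℕ} (z : Fin r → ℂ) (I : Fin r → ℤ) : ℂ :=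
  ∏ i, z i ^ (I i)

/-- The Laurent polynomial `p_a(z) = Σ_{I ∈ S} a(I) z^I`. -/
def pa {r : ℕ} (S : Finset (Fin r → ℤ)) (a : (Fin r → ℤ) → ℂ) (z : Fin r → ℂ) : ℂ :=
  ∑ I ∈ S, a I * lmon z I

/-- The algebraic torus `(ℂ*)^r`, as a subset of `ℂ^r`. -/
def torus (r : ℕ) : Set (Fin r → ℂ) := {z | ∀ i, z i ≠ 0}

/-- The zero set `Z(p_a) = {z ∈ (ℂ*)^r : p_a(z) = 0}`. -/
def Zset {r : ℕ} (S : Finset (Fin r → ℤ)) (a : (Fin r → ℤ) → ℂ) : Set (Fin r → ℂ) :=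
  {z | (∀ i, z i ≠ 0) ∧ pa S a z = 0}

/-- The coset `C(c,v) = {(c_1 t^{v_1}, …, c_r t^{v_r}) : t ∈ ℂ*}` of a
one-dimensional subtorus (for `c ∈ (ℂ*)^r` and `v ∈ ℤ^r` nonzero). -/
def coset {r : ℕ} (c : Fin r → ℂ) (v : Fin r → ℤ) : Set (Fin r → ℂ) :=
  {z | ∃ t : ℂ, t ≠ 0 ∧ z = fun i => c i * t ^ (v i)}

/-- The grouped coefficient `Q_{a,v,d}(c) = Σ_{I ∈ S, ⟨I,v⟩ = d} a(I) c^I`. -/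
def Qc {r : ℕ} (S : Finset (Fin r → ℤ)) (a : (Fin r → ℤ) → ℂ) (v : Fin r → ℤ)
    (d : ℤ) (c : Fin r → ℂ) : ℂ :=
  ∑ I ∈ S.filter (fun I => (∑ i, I i * v i) = d), a I * lmon c I

/-- The quantity in which the growth of the coefficient functions is measured. -/
def growthScale (T : ℝ → ℝ) (r R : ℝ) : ℝ := 2 + R + (R - r)⁻¹ + T R

/-- An entire function is slowly growing relative to `T` if on `‖z‖ ≤ r` it is bounded by a fixed
power of `growthScale T r R`, for all `R > r > 0`. -/
structure SlowlyGrowing (T : ℝ → ℝ) (A : ℂ → ℂ) : Prop where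
  differentiable : Differentiable ℂ A
  bound : ∃ K : ℕ, ∀ r R : ℝ, 0 < r → r < R → ∀ z : ℂ, ‖z‖ ≤ r → ‖A z‖ ≤ growthScale T r R ^ K

section SlowlyGrowing

variable {T : ℝ → ℝ} {A B : ℂ → ℂ}

lemma two_le_growthScale (hT : ∀ R, 0 ≤ T R) {r R : ℝ} (hr : 0 < r) (hR : r < R) :
    2 ≤ growthScale T r R := by
  have := hT R
  have : 0 < (R - r)⁻¹ := inv_pos.2 (sub_pos.2 hR)
  unfold growthScale
  linarith

lemma growthScale_midpoint_le (hT : ∀ R, 0 ≤ T R) {r R : ℝ} (hr : 0 < r) (hR : r < R) :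
    growthScale T ((r + R) / 2) R ≤ growthScale T r R ^ 2 := by
  have h2 := two_le_growthScale hT hr hR
  have hT' := hT R
  have hi : 0 < (R - r)⁻¹ := inv_pos.2 (sub_pos.2 hR)
  have he : (R - (r + R) / 2)⁻¹ = 2 * (R - r)⁻¹ := by
    rw [show R - (r + R) / 2 = (R - r) / 2 by ring, inv_div]
    ring
  have : growthScale T ((r + R) / 2) R ≤ 2 * growthScale T r R := by
    unfold growthScale
    rw [he]
    linarith
  nlinarith

lemma SlowlyGrowing.const (hT : ∀ R, 0 ≤ T R) (c : ℂ) : SlowlyGrowing T (fun _ => c) := by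
  refine ⟨by fun_prop, ?_⟩
  obtain ⟨K, hK⟩ := pow_unbounded_of_one_lt ‖c‖ (one_lt_two)
  refine ⟨K, fun r R hr hR z _ => hK.le.trans ?_⟩
  exact pow_le_pow_left₀ zero_le_two (two_le_growthScale hT hr hR) K

lemma SlowlyGrowing.add (hT : ∀ R, 0 ≤ T R) (hA : SlowlyGrowing T A) (hB : SlowlyGrowing T B) :
    SlowlyGrowing T (fun z => A z + B z) := by
  refine ⟨hA.differentiable.add hB.differentiable, ?_⟩
  obtain ⟨K, hK⟩ := hA.bound
  obtain ⟨L, hL⟩ := hB.bound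
  refine ⟨K + L + 1, fun r R hr hR z hz => ?_⟩
  have h2 := two_le_growthScale hT hr hR
  have h1 : (1 : ℝ) ≤ growthScale T r R := by linarith
  calc ‖A z + B z‖ ≤ ‖A z‖ + ‖B z‖ := norm_add_le _ _
    _ ≤ growthScale T r R ^ (K + L) + growthScale T r R ^ (K + L) := by
        gcongr
        · exact (hK r R hr hR z hz).trans (pow_le_pow_right₀ h1 (by omega))
        · exact (hL r R hr hR z hz).trans (pow_le_pow_right₀ h1 (by omega))
    _ = growthScale T r R ^ (K + L) * 2 := by ring
    _ ≤ growthScale T r R ^ (K + L + 1) := by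
        rw [pow_succ]
        gcongr

lemma SlowlyGrowing.mul (hT : ∀ R, 0 ≤ T R) (hA : SlowlyGrowing T A) (hB : SlowlyGrowing T B) :
    SlowlyGrowing T (fun z => A z * B z) := by
  refine ⟨hA.differentiable.mul hB.differentiable, ?_⟩
  obtain ⟨K, hK⟩ := hA.bound
  obtain ⟨L, hL⟩ := hB.bound
  refine ⟨K + L, fun r R hr hR z hz => ?_⟩
  have h2 := two_le_growthScale hT hr hR
  rw [norm_mul, pow_add]
  exact mul_le_mul (hK r R hr hR z hz) (hL r R hr hR z hz) (norm_nonneg _) (by positivity)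

lemma SlowlyGrowing.sub (hT : ∀ R, 0 ≤ T R) (hA : SlowlyGrowing T A) (hB : SlowlyGrowing T B) :
    SlowlyGrowing T (fun z => A z - B z) := by
  simpa [sub_eq_add_neg] using hA.add hT ((SlowlyGrowing.const hT (-1)).mul hT hB)

lemma SlowlyGrowing.sum (hT : ∀ R, 0 ≤ T R) {ι : Type*} (s : Finset ι) {A : ι → ℂ → ℂ}
    (hA : ∀ i, SlowlyGrowing T (A i)) : SlowlyGrowing T (fun z => ∑ i ∈ s, A i z) := by
  classical
  induction s using Finset.induction_on with
  | empty => simpa using SlowlyGrowing.const hT 0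
  | insert i s hi ih => simpa [Finset.sum_insert hi] using (hA i).add hT ih

lemma SlowlyGrowing.deriv (hT : ∀ R, 0 ≤ T R) (hA : SlowlyGrowing T A) :
    SlowlyGrowing T (deriv A) := by
  refine ⟨hA.differentiable.deriv, ?_⟩
  obtain ⟨K, hK⟩ := hA.bound
  refine ⟨2 * K + 2, fun r R hr hR z hz => ?_⟩
  have h2 := two_le_growthScale hT hr hR
  have hδ : 0 < (R - r) / 2 := by linarith
  have hle : ∀ w ∈ Metric.sphere z ((R - r) / 2), ‖A w‖ ≤ growthScale T r R ^ (2 * K) := by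
    intro w hw
    have hw' : ‖w‖ ≤ (r + R) / 2 := by
      have := norm_le_norm_add_norm_sub' w z
      rw [mem_sphere_iff_norm] at hw
      linarith
    have hmid : 2 ≤ growthScale T ((r + R) / 2) R :=
      two_le_growthScale hT (by linarith) (by linarith)
    rw [pow_mul]
    exact (hK _ R (by linarith) (by linarith) w hw').trans
      (pow_le_pow_left₀ (by linarith) (growthScale_midpoint_le hT hr hR) K)
  have hi : ((R - r) / 2)⁻¹ ≤ growthScale T r R ^ 2 := by
    have hi' : 0 < (R - r)⁻¹ := inv_pos.2 (sub_pos.2 hR)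
    have : (R - r)⁻¹ ≤ growthScale T r R := by
      have := hT R
      unfold growthScale
      linarith
    rw [inv_div, div_eq_mul_inv]
    nlinarith
  calc ‖_root_.deriv A z‖ ≤ growthScale T r R ^ (2 * K) / ((R - r) / 2) :=
        Complex.norm_deriv_le_of_forall_mem_sphere_norm_le hδ hA.differentiable.diffContOnCl hle
    _ ≤ growthScale T r R ^ (2 * K) * growthScale T r R ^ 2 := by
        rw [div_eq_mul_inv]
        gcongr
    _ = growthScale T r R ^ (2 * K + 2) := by ring

end SlowlyGrowing

/-- A Harnack-type bound for the real part of an entire function by its absolute mean on a larger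
circle. -/
lemma abs_re_le_of_circleAverage_le {g : ℂ → ℂ} (hg : Differentiable ℂ g) {R t : ℝ} {z : ℂ}
    (hz : ‖z‖ < R) (ht : Real.circleAverage (fun z => |(g z).re|) 0 R ≤ t) :
    |(g z).re| ≤ (R + ‖z‖) / (R - ‖z‖) * t := by
  have hR : 0 < R := (norm_nonneg z).trans_lt hz
  have hzb : z ∈ Metric.ball (0 : ℂ) R := by simpa using hz
  have hharm : InnerProductSpace.HarmonicOnNhd (fun z => (g z).re) (Metric.closedBall 0 R) :=
    fun x _ => (hg.analyticAt x).harmonicAt_re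
  have hP := hharm.circleAverage_re_herglotzRieszKernel_smul hzb
  have hc : Continuous fun z => (g z).re := Complex.continuous_re.comp hg.continuous
  have hk := continuousOn_herglotzRieszKernel_sphere hzb
  rw [← hP]
  refine Real.abs_circleAverage_le_circleAverage_abs.trans ?_
  calc _ ≤ Real.circleAverage (fun w => (R + ‖z‖) / (R - ‖z‖) * |(g w).re|) 0 R := by
        apply Real.circleAverage_mono
        · apply ContinuousOn.circleIntegrable'
          exact (((Complex.continuous_re.comp_continuousOn hk).smul hc.continuousOn).abs)
        · exact (continuous_const.mul hc.abs).continuousOn.circleIntegrable'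
        · intro w hw
          rw [abs_of_pos hR] at hw
          change |((w - 0 + (z - 0)) / ((w - 0) - (z - 0))).re * (g w).re| ≤ _
          rw [abs_mul]
          gcongr
          have h1 := re_herglotzRieszKernel_le hw hzb
          have h2 := le_re_herglotzRieszKernel hw hzb
          rw [sub_zero z] at h1 h2
          rw [sub_zero z, abs_of_nonneg]
          · exact h1
          · refine le_trans ?_ h2
            exact div_nonneg (by linarith) (by positivity)
    _ = (R + ‖z‖) / (R - ‖z‖) * Real.circleAverage (fun z => |(g z).re|) 0 R := by
        simpa using Real.circleAverage_fun_smul (a := (R + ‖z‖) / (R - ‖z‖))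
          (f := fun z => |(g z).re|) (c := 0) (R := R)
    _ ≤ _ := by
        have : 0 < R - ‖z‖ := by linarith
        gcongr

/-- A quantitative bound for an entire function by the mean of its real part on a larger circle. -/
lemma norm_le_of_circleAverage_le {g : ℂ → ℂ} (hg : Differentiable ℂ g) {r m R t : ℝ} {z : ℂ}
    (hz : ‖z‖ ≤ r) (hr : 0 < r) (hm : r < m) (hR : m < R) (ht0 : 0 ≤ t)
    (ht : Real.circleAverage (fun z => |(g z).re|) 0 R ≤ t) :
    ‖g z‖ ≤ 2 * ((R + m) / (R - m) * t + 1) * r / (m - r) + ‖g 0‖ * (m + r) / (m - r) := by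
  have hM : 0 ≤ (R + m) / (R - m) * t :=
    mul_nonneg (div_nonneg (by linarith) (by linarith)) ht0
  refine (Complex.borelCaratheodory (R := m) (M := (R + m) / (R - m) * t + 1) (by linarith)
    hg.differentiableOn ?_ (by linarith) (by simpa using hz.trans_lt hm)).trans ?_
  · intro w hw
    have hw' : ‖w‖ < m := by simpa using hw
    refine (le_abs_self _).trans ((abs_re_le_of_circleAverage_le hg (hw'.trans hR) ht).trans ?_)
    refine le_trans ?_ (le_add_of_nonneg_right zero_le_one)
    have : 0 < R - m := by linarith
    have : 0 ≤ R + m := by linarith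
    gcongr
  · have : 0 < m - r := by linarith
    have : 0 ≤ ‖g 0‖ * (m + r) := mul_nonneg (norm_nonneg _) (by linarith)
    gcongr

lemma SlowlyGrowing.of_circleAverage_le {T : ℝ → ℝ} (hT : ∀ R, 0 ≤ T R) {g : ℂ → ℂ}
    (hg : Differentiable ℂ g)
    (h : ∀ R, Real.circleAverage (fun z => |(g z).re|) 0 R ≤ T R) : SlowlyGrowing T g := by
  refine ⟨hg, ?_⟩
  obtain ⟨K, hK⟩ := pow_unbounded_of_one_lt ‖g 0‖ (one_lt_two)
  refine ⟨9 + (K + 4), fun r R hr hR z hz => ?_⟩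
  have hX := two_le_growthScale hT hr hR
  have hTR := hT R
  set X := growthScale T r R with hXdef
  have hi' : 0 < (R - r)⁻¹ := inv_pos.2 (sub_pos.2 hR)
  have hi : (R - r)⁻¹ ≤ X := by rw [hXdef, growthScale]; linarith
  have hRX : R ≤ X := by rw [hXdef, growthScale]; linarith
  have hTX : T R ≤ X := by rw [hXdef, growthScale]; linarith
  have hX0 : 0 ≤ X := by linarith
  have hX1 : 1 ≤ X := by linarith
  have hg0 : ‖g 0‖ ≤ X ^ K := hK.le.trans (pow_le_pow_left₀ zero_le_two hX K)
  have h := norm_le_of_circleAverage_le hg (m := (r + R) / 2) hz hr (by linarith) (by linarith)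
    hTR (h R)
  have e1 : R - (r + R) / 2 = (R - r) / 2 := by ring
  have e2 : (r + R) / 2 - r = (R - r) / 2 := by ring
  have hd : ((R - r) / 2)⁻¹ ≤ X * X := by
    rw [inv_div, div_eq_mul_inv]
    gcongr
  have hd0 : 0 ≤ ((R - r) / 2)⁻¹ := inv_nonneg.2 (by linarith)
  rw [e1, e2] at h
  simp only [div_eq_mul_inv _ ((R - r) / 2)] at h
  have hs1 : R + (r + R) / 2 ≤ X * X := by nlinarith
  have hs2 : (r + R) / 2 + r ≤ X * X := by nlinarith
  have hs0 : 0 ≤ (r + R) / 2 + r := by linarith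
  have hs3 : 0 ≤ R + (r + R) / 2 := by linarith
  have hR0 : 0 ≤ R := by linarith
  calc ‖g z‖ ≤ _ := h
    _ ≤ X * ((X * X) * (X * X) * X + (X * X) * (X * X) * X) * X * (X * X)
          + X ^ K * (X * X) * (X * X) := by
        have : (1 : ℝ) ≤ (X * X) * (X * X) * X := by
          have : 1 ≤ X * X := by nlinarith
          have : 1 ≤ (X * X) * (X * X) := by nlinarith
          nlinarith
        gcongr
        linarith
    _ ≤ X ^ (9 + (K + 4)) := by
        have h1 : (1 : ℝ) ≤ X ^ 8 := one_le_pow₀ hX1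
        have e3 : X * ((X * X) * (X * X) * X + (X * X) * (X * X) * X) * X * (X * X)
          + X ^ K * (X * X) * (X * X) = 2 * X ^ 9 + X ^ (K + 4) := by ring
        have h9 : 4 ≤ X ^ 9 := by
          have : (2 : ℝ) ^ 9 ≤ X ^ 9 := pow_le_pow_left₀ zero_le_two hX 9
          linarith
        have hK4 : 4 ≤ X ^ (K + 4) := by
          have : (2 : ℝ) ^ (K + 4) ≤ X ^ (K + 4) := pow_le_pow_left₀ zero_le_two hX _
          have : (2 : ℝ) ^ 4 ≤ 2 ^ (K + 4) := pow_le_pow_right₀ one_le_two (by omega)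
          linarith
        rw [e3, pow_add X 9]
        nlinarith

lemma exists_eq_const_mul_of_deriv_mul_eq {P Q : ℂ → ℂ} (hP : Differentiable ℂ P)
    (hQ : Differentiable ℂ Q) (h : ∀ z, deriv P z * Q z = P z * deriv Q z) {z₀ : ℂ}
    (hz₀ : Q z₀ ≠ 0) : ∃ c : ℂ, ∀ z, P z = c * Q z := by
  obtain ⟨ε, hε, hball⟩ := Metric.eventually_nhds_iff_ball.1
    (hQ.continuous.continuousAt.eventually_ne hz₀)
  have hder : ∀ z ∈ Metric.ball z₀ ε, HasDerivAt (fun z => P z / Q z) 0 z := by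
    intro z hz
    have := (hP z).hasDerivAt.div (hQ z).hasDerivAt (hball z hz)
    rwa [h z, sub_self, zero_div] at this
  obtain ⟨c, hc⟩ := Metric.isOpen_ball.exists_is_const_of_deriv_eq_zero
    (convex_ball z₀ ε).isPreconnected
    (fun z hz => (hder z hz).differentiableAt.differentiableWithinAt)
    (fun z hz => (hder z hz).deriv)
  refine ⟨c, fun z => ?_⟩
  have hPa : AnalyticOnNhd ℂ P Set.univ := fun x _ => hP.analyticAt x
  have hQa : AnalyticOnNhd ℂ (fun z => c * Q z) Set.univ :=
    fun x _ => (hQ.const_mul c).analyticAt x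
  refine congrFun (hPa.eq_of_eventuallyEq hQa (z₀ := z₀) ?_) z
  filter_upwards [Metric.ball_mem_nhds z₀ hε] with w hw
  exact (div_eq_iff (hball w hw)).1 (hc w hw)

section Borel

variable {T : ℝ → ℝ} {ι κ : Type*} {h : ι → ℂ → ℂ}

/-- Elimination of one summand from a relation between exponentials with slowly growing
coefficients. -/
lemma exists_sum_fiber_eq_const_mul [DecidableEq ι] [DecidableEq κ] (hT : ∀ R, 0 ≤ T R)
    (hh : ∀ i, SlowlyGrowing T (h i)) (d : ι → κ) {s : Finset ι} {m : ι}
    (ih : ∀ B : ι → ℂ → ℂ, (∀ i, SlowlyGrowing T (B i)) →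
      (∀ z, ∑ i ∈ s.erase m, B i z * Complex.exp (h i z) = 0) →
      ∀ k z, ∑ i ∈ s.erase m with d i = k, B i z * Complex.exp (h i z) = 0)
    {A : ι → ℂ → ℂ} (hA : ∀ i, SlowlyGrowing T (A i))
    (hsum : ∀ z, ∑ i ∈ s, A i z * Complex.exp (h i z) = 0) {z₀ : ℂ} (hz₀ : A m z₀ ≠ 0) (k : κ) :
    ∃ c : ℂ, ∀ z, ∑ i ∈ s with d i = k, A i z * Complex.exp (h i z)
      = c * (A m z * Complex.exp (h m z)) := by
  have hterm : ∀ i z, HasDerivAt (fun z => A i z * Complex.exp (h i z))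
      ((deriv (A i) z + A i z * deriv (h i) z) * Complex.exp (h i z)) z := by
    intro i z
    convert! ((hA i).differentiable z).hasDerivAt.mul
      ((hh i).differentiable z).hasDerivAt.cexp using 1
    ring
  have hsumder : ∀ (t : Finset ι) z, HasDerivAt (fun z => ∑ i ∈ t, A i z * Complex.exp (h i z))
      (∑ i ∈ t, (deriv (A i) z + A i z * deriv (h i) z) * Complex.exp (h i z)) z :=
    fun t z => HasDerivAt.fun_sum fun i _ => hterm i z
  let B : ι → ℂ → ℂ := fun i z => A m z * (deriv (A i) z + A i z * deriv (h i) z)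
    - A i z * (deriv (A m) z + A m z * deriv (h m) z)
  have hB : ∀ i, SlowlyGrowing T (B i) := fun i =>
    ((hA m).mul hT (((hA i).deriv hT).add hT ((hA i).mul hT ((hh i).deriv hT)))).sub hT
      ((hA i).mul hT (((hA m).deriv hT).add hT ((hA m).mul hT ((hh m).deriv hT))))
  have hBm : ∀ z, B m z = 0 := fun z => by simp only [B]; ring
  have hBsum : ∀ (t : Finset ι) z, ∑ i ∈ t, B i z * Complex.exp (h i z)
      = A m z * (∑ i ∈ t, (deriv (A i) z + A i z * deriv (h i) z) * Complex.exp (h i z))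
        - (∑ i ∈ t, A i z * Complex.exp (h i z)) *
          (deriv (A m) z + A m z * deriv (h m) z) := by
    intro t z
    rw [Finset.mul_sum, Finset.sum_mul, ← Finset.sum_sub_distrib]
    refine Finset.sum_congr rfl fun i _ => ?_
    simp only [B]
    ring
  have hBs : ∀ z, ∑ i ∈ s.erase m, B i z * Complex.exp (h i z) = 0 := by
    intro z
    rw [Finset.sum_erase _ (by simp [hBm]), hBsum, hsum]
    have h0 : (fun z => ∑ i ∈ s, A i z * Complex.exp (h i z)) = fun _ => 0 := funext hsum
    have := hsumder s z
    rw [h0] at this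
    rw [this.unique (hasDerivAt_const z 0)]
    ring
  have hfib : ∀ z, ∑ i ∈ s with d i = k, B i z * Complex.exp (h i z) = 0 := by
    intro z
    rw [← ih B hB hBs k z, Finset.filter_erase, Finset.sum_erase _ (by simp [hBm])]
  refine exists_eq_const_mul_of_deriv_mul_eq (fun z => (hsumder _ z).differentiableAt)
    (fun z => (hterm m z).differentiableAt) (fun z => ?_) (z₀ := z₀)
    (mul_ne_zero hz₀ (Complex.exp_ne_zero _))
  rw [(hsumder _ z).deriv, (hterm m z).deriv]
  have := hfib z
  rw [hBsum] at this
  linear_combination Complex.exp (h m z) * this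

/-- A form of **Borel's theorem**: a relation between exponentials with slowly growing coefficients
splits along any labelling `d` that separates only pairs of exponentials whose quotient is not a
quotient of slowly growing functions. -/
theorem sum_fiber_mul_exp_eq_zero [DecidableEq ι] [DecidableEq κ] (hT : ∀ R, 0 ≤ T R)
    (hh : ∀ i, SlowlyGrowing T (h i)) (d : ι → κ)
    (hd : ∀ i j, d i ≠ d j → ∀ A B : ℂ → ℂ, SlowlyGrowing T A → SlowlyGrowing T B →
      (∀ z, A z * Complex.exp (h i z) = B z * Complex.exp (h j z)) → ∀ z, A z = 0)
    (s : Finset ι) {A : ι → ℂ → ℂ} (hA : ∀ i, SlowlyGrowing T (A i))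
    (hsum : ∀ z, ∑ i ∈ s, A i z * Complex.exp (h i z) = 0) (k : κ) (z : ℂ) :
    ∑ i ∈ s with d i = k, A i z * Complex.exp (h i z) = 0 := by
  induction s using Finset.strongInduction generalizing A k z with
  | H s ih =>
  have key : ∀ m ∈ s, (∃ z₀, A m z₀ ≠ 0) → ∀ k, ∃ c : ℂ, ∀ z,
      ∑ i ∈ s with d i = k, A i z * Complex.exp (h i z) = c * (A m z * Complex.exp (h m z)) :=
    fun m hm ⟨z₀, hz₀⟩ k => exists_sum_fiber_eq_const_mul hT hh d
      (fun B hB hBs k z => ih _ (Finset.erase_ssubset hm) hB hBs k z) hA hsum hz₀ k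
  by_contra hne
  obtain ⟨i, hi, hi0⟩ := Finset.exists_ne_zero_of_sum_ne_zero hne
  rw [Finset.mem_filter] at hi
  have hne' : ∑ j ∈ s with ¬ d j = k, A j z * Complex.exp (h j z) ≠ 0 := by
    intro h0
    have := Finset.sum_filter_add_sum_filter_not s (fun j => d j = k)
      (fun j => A j z * Complex.exp (h j z))
    rw [h0, hsum, add_zero] at this
    exact hne this
  obtain ⟨j, hj, hj0⟩ := Finset.exists_ne_zero_of_sum_ne_zero hne'
  rw [Finset.mem_filter] at hj
  obtain ⟨c, hc⟩ := key i hi.1 ⟨z, left_ne_zero_of_mul hi0⟩ k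
  obtain ⟨c', hc'⟩ := key j hj.1 ⟨z, left_ne_zero_of_mul hj0⟩ k
  have hz := hd i j (by rw [hi.2]; exact fun h => hj.2 h.symm) (fun z => c * A i z)
    (fun z => c' * A j z) ((SlowlyGrowing.const hT c).mul hT (hA i))
    ((SlowlyGrowing.const hT c').mul hT (hA j))
    (fun w => by rw [mul_assoc, mul_assoc, ← hc, ← hc']) z
  apply hne
  rw [hc, ← mul_assoc, hz, zero_mul]

end Borel

/-- Every nowhere vanishing entire function has an entire logarithm. -/
lemma exists_entire_log {f : ℂ → ℂ} (hf : Differentiable ℂ f) (h0 : ∀ z, f z ≠ 0) :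
    ∃ g : ℂ → ℂ, Differentiable ℂ g ∧ ∀ z, Complex.exp (g z) = f z := by
  have hd : Differentiable ℂ fun z => deriv f z / f z := hf.deriv.div hf h0
  obtain ⟨g, hg0, hg⟩ := hd.isExactOn_univ.with_val_at 0 (Complex.log (f 0))
  have hg' : ∀ z, HasDerivAt g (deriv f z / f z) z := fun z => hg z (Set.mem_univ z)
  refine ⟨g, fun z => (hg' z).differentiableAt, fun z => ?_⟩
  have hq : ∀ z, HasDerivAt (fun z => Complex.exp (g z) / f z) 0 z := by
    intro z
    convert! (hg' z).cexp.div (hf z).hasDerivAt (h0 z) using 1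
    have := h0 z
    field_simp
    ring
  have := is_const_of_deriv_eq_zero (fun z => (hq z).differentiableAt) (fun z => (hq z).deriv) z 0
  simp only [hg0, Complex.exp_log (h0 0), div_self (h0 0)] at this
  exact (div_eq_one_iff_eq (h0 z)).1 this

/-- The lower bound in Jensen's formula for an entire function. -/
lemma log_norm_trailingCoeff_le_circleAverage {A : ℂ → ℂ} (hA : Differentiable ℂ A) {r : ℝ}
    (hr : 1 ≤ r) :
    Real.log ‖meromorphicTrailingCoeffAt A 0‖ ≤ Real.circleAverage (Real.log ‖A ·‖) 0 r := by
  have hr0 : 0 < r := by linarith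
  have han : AnalyticOnNhd ℂ A (Metric.closedBall 0 |r|) := fun x _ => hA.analyticAt x
  have hdiv := MeromorphicOn.AnalyticOnNhd.divisor_nonneg han
  rw [MeromorphicOn.circleAverage_log_norm hr0.ne' han.meromorphicOn]
  refine le_add_of_nonneg_left (add_nonneg (finsum_nonneg fun u => ?_) ?_)
  · by_cases hu : u ∈ Metric.closedBall (0 : ℂ) |r|
    · refine mul_nonneg (by exact_mod_cast hdiv u) ?_
      rcases eq_or_ne u 0 with rfl | hu0
      · simp
      · have hu' : ‖u‖ ≤ r := by simpa [abs_of_pos hr0] using hu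
        apply Real.log_nonneg
        rw [zero_sub, norm_neg, ← div_eq_mul_inv, one_le_div (norm_pos_iff.2 hu0)]
        exact hu'
    · simp [Function.locallyFinsuppWithin.apply_eq_zero_of_notMem _ hu]
  · exact mul_nonneg (by exact_mod_cast hdiv 0) (Real.log_nonneg hr)

section Mean

variable {T : ℝ → ℝ} {A B h : ℂ → ℂ}

/-- The function `h` has real part of logarithmically bounded mean relative to `T`. -/
def LogBoundedMean (T : ℝ → ℝ) (h : ℂ → ℂ) : Prop :=
  ∃ K : ℝ, ∀ r R : ℝ, 1 ≤ r → r < R →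
    Real.circleAverage (fun z => |(h z).re|) 0 r ≤ K * Real.log (growthScale T r R)

lemma SlowlyGrowing.circleAverage_abs_log_le (hT : ∀ R, 0 ≤ T R) (hA : SlowlyGrowing T A) :
    ∃ K : ℝ, ∀ r R : ℝ, 1 ≤ r → r < R →
      Real.circleAverage (fun z => |Real.log ‖A z‖|) 0 r ≤
        K * Real.log (growthScale T r R) := by
  obtain ⟨K, hK⟩ := hA.bound
  set C := |Real.log ‖meromorphicTrailingCoeffAt A 0‖| with hC
  refine ⟨2 * K + C / Real.log 2, fun r R hr hR => ?_⟩
  have hr0 : 0 < r := by linarith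
  have hX := two_le_growthScale hT hr0 hR
  have hl2 : 0 < Real.log 2 := Real.log_pos one_lt_two
  have hlX : Real.log 2 ≤ Real.log (growthScale T r R) := Real.log_le_log two_pos hX
  have hmer : MeromorphicOn A (Metric.sphere 0 |r|) :=
    fun x _ => (hA.differentiable.analyticAt x).meromorphicAt
  have hint : CircleIntegrable (Real.log ‖A ·‖) 0 r := hmer.circleIntegrable_log_norm
  have hlow := log_norm_trailingCoeff_le_circleAverage hA.differentiable hr
  have hpt : ∀ z ∈ Metric.sphere (0 : ℂ) |r|, |Real.log ‖A z‖| + Real.log ‖A z‖ ≤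
      2 * K * Real.log (growthScale T r R) := by
    intro z hz
    have hz' : ‖z‖ ≤ r := by simpa [abs_of_pos hr0] using (mem_sphere_zero_iff_norm.1 hz).le
    have hKX : 0 ≤ K * Real.log (growthScale T r R) :=
      mul_nonneg (Nat.cast_nonneg K) (by linarith)
    have : Real.log ‖A z‖ ≤ K * Real.log (growthScale T r R) := by
      rcases eq_or_ne (A z) 0 with h0 | h0
      · simpa [h0] using hKX
      · rw [← Real.log_pow]
        exact Real.log_le_log (norm_pos_iff.2 h0) (hK r R hr0 hR z hz')
    rcases abs_cases (Real.log ‖A z‖) with ⟨h1, _⟩ | ⟨h1, _⟩ <;> rw [h1] <;> nlinarith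
  have hup := Real.circleAverage_mono_on_of_le_circle (hint.abs.add hint) hpt
  rw [Real.circleAverage_add hint.abs hint] at hup
  have hCle : C ≤ C / Real.log 2 * Real.log (growthScale T r R) := by
    rw [div_mul_eq_mul_div, le_div_iff₀ hl2]
    exact mul_le_mul_of_nonneg_left hlX (abs_nonneg _)
  have : -C ≤ Real.log ‖meromorphicTrailingCoeffAt A 0‖ := neg_abs_le _
  calc _ ≤ 2 * K * Real.log (growthScale T r R) + C := by
        change Real.circleAverage |(Real.log ‖A ·‖)| 0 r ≤ _
        linarith
    _ ≤ _ := by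
        rw [add_mul]
        linarith

lemma Differentiable.circleIntegrable_abs_re (hh : Differentiable ℂ h) (c : ℂ) (r : ℝ) :
    CircleIntegrable (fun z => |(h z).re|) c r :=
  (Complex.continuous_re.comp hh.continuous).abs.continuousOn.circleIntegrable'

lemma LogBoundedMean.of_mul_exp_eq (hT : ∀ R, 0 ≤ T R) (hh : Differentiable ℂ h)
    (hA : SlowlyGrowing T A) (hB : SlowlyGrowing T B)
    (heq : ∀ z, A z * Complex.exp (h z) = B z) {z₀ : ℂ} (hz₀ : A z₀ ≠ 0) :
    LogBoundedMean T h := by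
  obtain ⟨K, hK⟩ := hA.circleAverage_abs_log_le hT
  obtain ⟨L, hL⟩ := hB.circleAverage_abs_log_le hT
  refine ⟨K + L, fun r R hr hR => ?_⟩
  have hr0 : 0 < r := by linarith
  have hmA : MeromorphicOn A (Metric.sphere 0 |r|) :=
    fun x _ => (hA.differentiable.analyticAt x).meromorphicAt
  have hmB : MeromorphicOn B (Metric.sphere 0 |r|) :=
    fun x _ => (hB.differentiable.analyticAt x).meromorphicAt
  have hiA : CircleIntegrable (fun z => |Real.log ‖A z‖|) 0 r :=
    hmA.circleIntegrable_log_norm.abs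
  have hiB : CircleIntegrable (fun z => |Real.log ‖B z‖|) 0 r :=
    hmB.circleIntegrable_log_norm.abs
  have hih := hh.circleIntegrable_abs_re 0 r
  have hne : ∀ᶠ z in Filter.codiscreteWithin (Metric.sphere (0 : ℂ) |r|), A z ≠ 0 := by
    have han : AnalyticOnNhd ℂ A Set.univ := fun x _ => hA.differentiable.analyticAt x
    have := han.preimage_zero_mem_codiscrete hz₀
    exact Filter.codiscreteWithin_mono (Set.subset_univ _) this
  classical
  have hcongr : (fun z => |(h z).re|) =ᶠ[Filter.codiscreteWithin (Metric.sphere (0 : ℂ) |r|)]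
      fun z => if A z = 0 then 0 else |(h z).re| := by
    filter_upwards [hne] with z hz
    simp [hz]
  rw [Real.circleAverage_congr_codiscreteWithin hcongr hr0.ne', add_mul]
  refine le_trans ?_ (add_le_add (hK r R hr hR) (hL r R hr hR))
  rw [← Real.circleAverage_fun_add hiA hiB]
  refine Real.circleAverage_mono (hih.congr_codiscreteWithin hcongr) (hiA.add hiB)
    fun z _ => ?_
  by_cases hz : A z = 0
  · simp only [hz, if_true]
    positivity
  · rw [if_neg hz]
    have hlog : Real.log ‖B z‖ = Real.log ‖A z‖ + (h z).re := by
      rw [← heq, norm_mul, Complex.norm_exp, Real.log_mul (norm_ne_zero_iff.2 hz)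
        (Real.exp_ne_zero _), Real.log_exp]
    rw [hlog]
    have := abs_sub (Real.log ‖A z‖ + (h z).re) (Real.log ‖A z‖)
    rw [add_sub_cancel_left] at this
    change _ ≤ |Real.log ‖A z‖| + |Real.log ‖A z‖ + (h z).re|
    linarith

lemma LogBoundedMean.zero : LogBoundedMean T fun _ => 0 :=
  ⟨0, fun r R _ _ => by simp [Real.circleAverage_const]⟩

lemma LogBoundedMean.add (hA : Differentiable ℂ A) (hB : Differentiable ℂ B)
    (hmA : LogBoundedMean T A) (hmB : LogBoundedMean T B) :
    LogBoundedMean T fun z => A z + B z := by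
  obtain ⟨K, hK⟩ := hmA
  obtain ⟨L, hL⟩ := hmB
  refine ⟨K + L, fun r R hr hR => ?_⟩
  have hiA := hA.circleIntegrable_abs_re 0 r
  have hiB := hB.circleIntegrable_abs_re 0 r
  rw [add_mul]
  refine le_trans ?_ (add_le_add (hK r R hr hR) (hL r R hr hR))
  rw [← Real.circleAverage_fun_add hiA hiB]
  exact Real.circleAverage_mono ((hA.add hB).circleIntegrable_abs_re 0 r) (hiA.add hiB)
    fun z _ => by simpa using abs_add_le (A z).re (B z).re

lemma LogBoundedMean.const_mul (q : ℝ) (hA : LogBoundedMean T A) :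
    LogBoundedMean T fun z => q * A z := by
  obtain ⟨K, hK⟩ := hA
  refine ⟨|q| * K, fun r R hr hR => ?_⟩
  have := Real.circleAverage_fun_smul (a := |q|) (f := fun z => |(A z).re|) (c := 0) (R := r)
  simp only [smul_eq_mul] at this
  simp only [Complex.re_ofReal_mul, abs_mul]
  rw [this, mul_assoc]
  exact mul_le_mul_of_nonneg_left (hK r R hr hR) (abs_nonneg q)

end Mean

/-- A growth lemma in the style of E. Borel. -/
lemma exists_apply_add_inv_le_two_mul {T : ℝ → ℝ} {r₀ : ℝ}
    (hb : BddAbove (T '' Set.Icc r₀ (r₀ + 2))) (h1 : ∀ r, r₀ ≤ r → 1 ≤ T r) :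
    ∃ r, r₀ ≤ r ∧ T (r + (T r)⁻¹) ≤ 2 * T r := by
  by_contra! hcon
  obtain ⟨M, hM⟩ := hb
  let u : ℕ → ℝ := fun k => (fun x => x + (T x)⁻¹)^[k] r₀
  have hu : ∀ k, r₀ ≤ u k ∧ u k ≤ r₀ + 2 - 2 * (2 ^ k)⁻¹ ∧ 2 ^ k ≤ T (u k) := by
    intro k
    induction k with
    | zero => simpa [u] using h1 r₀ le_rfl
    | succ k ih =>
      obtain ⟨hl, hr, hT⟩ := ih
      have hs : u (k + 1) = u k + (T (u k))⁻¹ := Function.iterate_succ_apply' _ _ _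
      have hpos : 0 < T (u k) := zero_lt_one.trans_le (h1 _ hl)
      have hinv : (T (u k))⁻¹ ≤ (2 ^ k)⁻¹ := inv_anti₀ (by positivity) hT
      have h0 : 0 < (T (u k))⁻¹ := inv_pos.2 hpos
      have hhalf : 2 * ((2 : ℝ) ^ (k + 1))⁻¹ = (2 ^ k)⁻¹ := by
        rw [pow_succ]
        field_simp
      refine ⟨by linarith, by linarith, ?_⟩
      rw [hs, pow_succ]
      linarith [hcon _ hl]
  obtain ⟨k, hk⟩ := pow_unbounded_of_one_lt M one_lt_two
  obtain ⟨hl, hr, hT⟩ := hu k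
  have : (0 : ℝ) < (2 ^ k)⁻¹ := by positivity
  linarith [hM ⟨u k, ⟨hl, by linarith⟩, rfl⟩]

/-- A function of at least linear growth is not logarithmically bounded in terms of itself. -/
lemma not_le_mul_log_growthScale {T : ℝ → ℝ}
    (hb : ∀ r, BddAbove (T '' Set.Icc r (r + 2))) {C : ℝ} (hC : ∀ r, 0 < r → r ≤ C * (T r + 1))
    (hT : ∀ r, 0 ≤ T r) (K : ℝ) :
    ¬ ∀ r R : ℝ, 1 ≤ r → r < R → T r ≤ K * Real.log (growthScale T r R) := by
  intro hK
  have hC0 : 0 < C := by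
    by_contra! h
    nlinarith [hC 1 one_pos, hT 1]
  set D := 2 * C + 6 with hD
  have hD0 : 0 < D := by positivity
  have hlim : Filter.Tendsto T Filter.atTop Filter.atTop := by
    have h : Filter.Tendsto (fun r : ℝ => r / C - 1) Filter.atTop Filter.atTop :=
      Filter.tendsto_atTop_add_const_right _ _ (Filter.tendsto_id.atTop_div_const hC0)
    refine Filter.tendsto_atTop_mono' _ ?_ h
    filter_upwards [Filter.eventually_gt_atTop 0] with r hr
    rw [sub_le_iff_le_add, div_le_iff₀' hC0]
    exact hC r hr
  have hlog : ∀ᶠ t : ℝ in Filter.atTop, |K| * Real.log (D * t) < t := by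
    have h := (Real.isLittleO_log_id_atTop.comp_tendsto
      (Filter.tendsto_id.const_mul_atTop hD0)).bound
      (c := (2 * (|K| + 1) * D)⁻¹) (by positivity)
    filter_upwards [h, Filter.eventually_gt_atTop 0] with t ht ht0
    simp only [Function.comp, id, Real.norm_eq_abs, abs_of_pos (mul_pos hD0 ht0)] at ht
    have h1 := (le_abs_self _).trans ht
    have h2 : (2 * (|K| + 1) * D)⁻¹ * (D * t) = t / (2 * (|K| + 1)) := by field_simp
    rw [h2, le_div_iff₀ (by positivity)] at h1
    have h3 := abs_nonneg K
    by_contra! h4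
    rcases le_or_gt (Real.log (D * t)) 0 with h5 | h5
    · nlinarith
    · nlinarith
  obtain ⟨r₀, hr₀⟩ := Filter.eventually_atTop.1 ((hlim.eventually hlog).and
    ((hlim.eventually_ge_atTop 1).and (Filter.eventually_ge_atTop 1)))
  obtain ⟨r, hr, hrT⟩ := exists_apply_add_inv_le_two_mul (hb r₀) fun r hr => (hr₀ r hr).2.1
  obtain ⟨h1, h2, h3⟩ := hr₀ r hr
  have hinv : 0 < (T r)⁻¹ := inv_pos.2 (by linarith)
  have hinv1 : (T r)⁻¹ ≤ 1 := inv_le_one_of_one_le₀ h2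
  have hlt : r < r + (T r)⁻¹ := by linarith
  have hle : growthScale T r (r + (T r)⁻¹) ≤ D * T r := by
    have := hC r (by linarith)
    rw [growthScale, add_sub_cancel_left, inv_inv, hD]
    nlinarith
  have hge := two_le_growthScale hT (by linarith) hlt
  have h0 : 0 ≤ Real.log (growthScale T r (r + (T r)⁻¹)) := Real.log_nonneg (by linarith)
  have hfin := hK r _ h3 hlt
  have h5 : K * Real.log (growthScale T r (r + (T r)⁻¹)) ≤ |K| * Real.log (D * T r) := by
    refine (mul_le_mul_of_nonneg_right (le_abs_self K) h0).trans ?_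
    exact mul_le_mul_of_nonneg_left (Real.log_le_log (by linarith) hle) (abs_nonneg K)
  linarith

/-- The mean of the real part of an entire function with nonzero derivative at the origin grows at
least linearly. -/
lemma exists_le_mul_circleAverage {g : ℂ → ℂ} (hg : Differentiable ℂ g) (h0 : deriv g 0 ≠ 0) :
    ∃ C : ℝ, 0 ≤ C ∧ ∀ R, 0 < R →
      R ≤ C * (Real.circleAverage (fun z => |(g z).re|) 0 R + 1) := by
  have hd : 0 < ‖deriv g 0‖ := norm_pos_iff.2 h0
  refine ⟨(24 + 12 * ‖g 0‖) / ‖deriv g 0‖, by positivity, fun R hR => ?_⟩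
  set t := Real.circleAverage (fun z => |(g z).re|) 0 R with ht
  have ht0 : 0 ≤ t := Real.circleAverage_nonneg_of_nonneg fun _ _ => abs_nonneg _
  have hbound : ∀ z ∈ Metric.sphere (0 : ℂ) (R / 4), ‖g z‖ ≤ 6 * t + 2 + 3 * ‖g 0‖ := by
    intro z hz
    have := norm_le_of_circleAverage_le hg (r := R / 4) (m := R / 2) (R := R)
      (mem_sphere_zero_iff_norm.1 hz).le (by linarith) (by linarith) (by linarith) ht0 ht.ge
    convert! this using 1
    field_simp
    ring
  have hder := Complex.norm_deriv_le_of_forall_mem_sphere_norm_le (by linarith)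
    hg.diffContOnCl hbound
  rw [le_div_iff₀ (by linarith)] at hder
  rw [div_mul_eq_mul_div, le_div_iff₀ hd]
  nlinarith [norm_nonneg (g 0), mul_nonneg (norm_nonneg (g 0)) ht0]

section TotalMean

variable {ι : Type*} [Fintype ι] {G : ι → ℂ → ℂ}

/-- The sum of the means on the circle of radius `R` of the real parts of a family of functions. -/
def totalMean (G : ι → ℂ → ℂ) (R : ℝ) : ℝ :=
  ∑ i, Real.circleAverage (fun z => |(G i z).re|) 0 R

lemma circleAverage_abs_re_nonneg (g : ℂ → ℂ) (R : ℝ) :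
    0 ≤ Real.circleAverage (fun z => |(g z).re|) 0 R :=
  Real.circleAverage_nonneg_of_nonneg fun _ _ => abs_nonneg _

lemma totalMean_nonneg (G : ι → ℂ → ℂ) (R : ℝ) : 0 ≤ totalMean G R :=
  Finset.sum_nonneg fun i _ => circleAverage_abs_re_nonneg (G i) R

lemma circleAverage_le_totalMean (G : ι → ℂ → ℂ) (i : ι) (R : ℝ) :
    Real.circleAverage (fun z => |(G i z).re|) 0 R ≤ totalMean G R :=
  Finset.single_le_sum (f := fun i => Real.circleAverage (fun z => |(G i z).re|) 0 R)
    (fun i _ => circleAverage_abs_re_nonneg (G i) R) (Finset.mem_univ i)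

lemma bddAbove_totalMean_image_Icc (hG : ∀ i, Differentiable ℂ (G i)) (a b : ℝ) :
    BddAbove (totalMean G '' Set.Icc a b) := by
  have hM : ∀ i, ∃ M : ℝ, ∀ z ∈ Metric.closedBall (0 : ℂ) (max |a| |b|), |(G i z).re| ≤ M := by
    intro i
    have hc : Continuous fun z => |(G i z).re| :=
      (Complex.continuous_re.comp (hG i).continuous).abs
    obtain ⟨M, hM⟩ := ((isCompact_closedBall (0 : ℂ) (max |a| |b|)).image hc).bddAbove
    exact ⟨M, fun z hz => hM ⟨z, hz, rfl⟩⟩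
  choose M hM using hM
  refine ⟨∑ i, M i, ?_⟩
  rintro _ ⟨R, hR, rfl⟩
  refine Finset.sum_le_sum fun i _ => ?_
  refine Real.circleAverage_mono_on_of_le_circle ((hG i).circleIntegrable_abs_re 0 R)
    fun z hz => hM i z ?_
  rw [mem_sphere_zero_iff_norm] at hz
  rw [mem_closedBall_zero_iff, hz]
  exact abs_le_max_abs_abs hR.1 hR.2

lemma SlowlyGrowing.of_totalMean (hG : ∀ i, Differentiable ℂ (G i)) (i : ι) :
    SlowlyGrowing (totalMean G) (G i) :=
  .of_circleAverage_le (totalMean_nonneg G) (hG i) (circleAverage_le_totalMean G i)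

lemma exists_not_logBoundedMean_totalMean (hG : ∀ i, Differentiable ℂ (G i)) {j : ι}
    (hj : deriv (G j) 0 ≠ 0) : ∃ i, ¬ LogBoundedMean (totalMean G) (G i) := by
  by_contra! h
  choose K hK using h
  obtain ⟨C, hC0, hC⟩ := exists_le_mul_circleAverage (hG j) hj
  refine not_le_mul_log_growthScale (fun r => bddAbove_totalMean_image_Icc hG r (r + 2)) (C := C)
    (fun r hr => (hC r hr).trans ?_) (totalMean_nonneg G) (∑ i, K i) fun r R hr hR => ?_
  · gcongr
    exact circleAverage_le_totalMean G j r
  · rw [Finset.sum_mul]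
    exact Finset.sum_le_sum fun i _ => hK i r R hr hR

end TotalMean

/-- A proper rational subspace is annihilated by a nonzero integer vector. -/
lemma exists_int_ne_zero_forall_sum_mul_eq_zero {ι : Type*} [Fintype ι]
    {W : Submodule ℚ (ι → ℚ)} (hW : W ≠ ⊤) :
    ∃ v : ι → ℤ, v ≠ 0 ∧ ∀ w ∈ W, ∑ i, w i * v i = 0 := by
  classical
  obtain ⟨φ, hφ, hle⟩ := Submodule.exists_le_ker_of_lt_top W hW.lt_top
  obtain ⟨b, hb⟩ := IsLocalization.exist_integer_multiples_of_finite (nonZeroDivisors ℤ)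
    fun i => φ (Pi.single i 1)
  choose v hv using hb
  have hv' : ∀ i, (v i : ℚ) = (b : ℤ) * φ (Pi.single i 1) := fun i => by simpa using hv i
  have hb0 : ((b : ℤ) : ℚ) ≠ 0 := by exact_mod_cast nonZeroDivisors.coe_ne_zero b
  have hsum : ∀ w : ι → ℚ, ∑ i, w i * v i = (b : ℤ) * φ w := by
    intro w
    rw [LinearMap.pi_apply_eq_sum_univ φ w, Finset.mul_sum]
    refine Finset.sum_congr rfl fun i _ => ?_
    have : (fun j => if i = j then (1 : ℚ) else 0) = Pi.single i 1 := by
      ext j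
      simp [Pi.single_apply, eq_comm]
    rw [hv', this, smul_eq_mul]
    ring
  refine ⟨v, ?_, fun w hw => ?_⟩
  · rintro rfl
    refine hφ (LinearMap.ext fun w => ?_)
    have := hsum w
    simpa [hb0] using this.symm
  · rw [hsum, LinearMap.mem_ker.1 (hle hw), mul_zero]

lemma lmon_exp {r : ℕ} (g : Fin r → ℂ) (I : Fin r → ℤ) :
    lmon (fun i => Complex.exp (g i)) I = Complex.exp (∑ i, I i * g i) := by
  simp only [lmon, Complex.exp_sum, Complex.exp_int_mul]

lemma lmon_mul_zpow {r : ℕ} (c : Fin r → ℂ) (v I : Fin r → ℤ) {t : ℂ} (ht : t ≠ 0) :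
    lmon (fun i => c i * t ^ v i) I = lmon c I * t ^ (∑ i, I i * v i) := by
  have hp : ∀ s : Finset (Fin r), ∏ i ∈ s, t ^ (I i * v i) = t ^ (∑ i ∈ s, I i * v i) := by
    intro s
    induction s using Finset.induction_on with
    | empty => simp
    | insert i s hi ih => rw [Finset.prod_insert hi, Finset.sum_insert hi, ih, zpow_add₀ ht]
  simp only [lmon]
  rw [← hp, ← Finset.prod_mul_distrib]
  refine Finset.prod_congr rfl fun i _ => ?_
  rw [mul_zpow, ← zpow_mul, mul_comm (v i)]

lemma coset_subset_Zset {r : ℕ} {S : Finset (Fin r → ℤ)} {a : (Fin r → ℤ) → ℂ}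
    {c : Fin r → ℂ} {v : Fin r → ℤ} (hc : ∀ i, c i ≠ 0) (hQ : ∀ d, Qc S a v d c = 0) :
    coset c v ⊆ Zset S a := by
  rintro _ ⟨t, ht, rfl⟩
  refine ⟨fun i => mul_ne_zero (hc i) (zpow_ne_zero _ ht), ?_⟩
  rw [pa, ← Finset.sum_fiberwise_of_maps_to
    (fun I hI => Finset.mem_image_of_mem (fun I : Fin r → ℤ => ∑ i, I i * v i) hI)]
  refine Finset.sum_eq_zero fun d _ => ?_
  have := hQ d
  rw [Qc] at this
  rw [← zero_mul (t ^ d), ← this, Finset.sum_mul]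
  refine Finset.sum_congr rfl fun I hI => ?_
  rw [lmon_mul_zpow c v I ht, (Finset.mem_filter.1 hI).2, mul_assoc]

/-- Some nonzero integer direction is orthogonal to all integral combinations of a nonconstant
family of entire functions whose real part has logarithmically bounded mean. -/
lemma exists_int_ne_zero_forall_logBoundedMean {ι : Type*} [Fintype ι] {G : ι → ℂ → ℂ}
    (hG : ∀ i, Differentiable ℂ (G i)) {j : ι} (hj : deriv (G j) 0 ≠ 0) :
    ∃ v : ι → ℤ, v ≠ 0 ∧ ∀ u : ι → ℤ,
      LogBoundedMean (totalMean G) (fun z => ∑ i, u i * G i z) → ∑ i, u i * v i = 0 := by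
  classical
  have hlin : ∀ w : ι → ℝ, Differentiable ℂ fun z => ∑ i, (w i : ℂ) * G i z :=
    fun w => Differentiable.fun_sum fun i _ => (hG i).const_mul _
  let W : Submodule ℚ (ι → ℚ) :=
    { carrier := {w | LogBoundedMean (totalMean G) fun z => ∑ i, ((w i : ℝ) : ℂ) * G i z}
      zero_mem' := by simpa using LogBoundedMean.zero
      add_mem' := fun {w w'} hw hw' => by
        have := LogBoundedMean.add (hlin fun i => w i) (hlin fun i => w' i) hw hw'
        simpa [add_mul, Finset.sum_add_distrib] using this
      smul_mem' := fun q w hw => by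
        have := LogBoundedMean.const_mul q hw
        simpa [Finset.mul_sum, mul_assoc] using this }
  have hW : W ≠ ⊤ := by
    intro htop
    obtain ⟨i, hi⟩ := exists_not_logBoundedMean_totalMean hG hj
    have : Pi.single i 1 ∈ W := htop ▸ Submodule.mem_top
    apply hi
    change LogBoundedMean _ _ at this
    convert this using 2 with z
    rw [Finset.sum_eq_single i (fun k _ hk => by simp [hk]) (by simp)]
    simp
  obtain ⟨v, hv0, hv⟩ := exists_int_ne_zero_forall_sum_mul_eq_zero hW
  refine ⟨v, hv0, fun u hu => ?_⟩
  have hmem : (fun i => (u i : ℚ)) ∈ W := by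
    change LogBoundedMean _ _
    simpa using hu
  exact_mod_cast hv _ hmem

/-- Along a nonconstant entire curve of exponentials in the zero set of `p_a`, all grouped
coefficients for a suitable direction vanish. -/
lemma exists_forall_Qc_eq_zero {r : ℕ} {S : Finset (Fin r → ℤ)} {a : (Fin r → ℤ) → ℂ}
    {G : Fin r → ℂ → ℂ} (hG : ∀ i, Differentiable ℂ (G i)) {j : Fin r} (hj : deriv (G j) 0 ≠ 0)
    (hp : ∀ z, pa S a (fun i => Complex.exp (G i z)) = 0) :
    ∃ v : Fin r → ℤ, v ≠ 0 ∧ ∀ d z, Qc S a v d (fun i => Complex.exp (G i z)) = 0 := by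
  have hT := totalMean_nonneg G
  obtain ⟨v, hv0, hv⟩ := exists_int_ne_zero_forall_logBoundedMean hG hj
  have hlin : ∀ I : Fin r → ℤ, SlowlyGrowing (totalMean G) fun z => ∑ i, I i * G i z :=
    fun I => .sum hT _ fun i => (SlowlyGrowing.const hT _).mul hT (.of_totalMean hG i)
  refine ⟨v, hv0, fun d z => ?_⟩
  simp only [Qc, lmon_exp]
  refine sum_fiber_mul_exp_eq_zero hT hlin (fun I => ∑ i, I i * v i)
    (fun I J hIJ A B hA hB hAB => ?_) S (A := fun I _ => a I)
    (fun I => .const hT _) (fun z => by simpa only [pa, lmon_exp] using hp z) d z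
  by_contra! hne
  obtain ⟨z₀, hz₀⟩ := hne
  refine hIJ (sub_eq_zero.1 ?_)
  rw [← Finset.sum_sub_distrib]
  simp only [← sub_mul]
  refine hv (fun i => I i - J i)
    (.of_mul_exp_eq hT (hlin fun i => I i - J i).differentiable hA hB (fun z => ?_) hz₀)
  simp only [Int.cast_sub, sub_mul, Finset.sum_sub_distrib]
  rw [Complex.exp_sub, mul_div_assoc', hAB, mul_div_assoc, div_self (Complex.exp_ne_zero _),
    mul_one]

/-- If `Z(p_a)` contains no coset of a one-dimensional subtorus, then every entire map
`f : ℂ → ℂ^r` with nowhere-vanishing coordinates lying inside the zero set of `p_a` is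
constant. -/
theorem entire_curve_in_zero_set_is_constant {r : ℕ} (hr : 1 ≤ r)
    (S : Finset (Fin r → ℤ)) (a : (Fin r → ℤ) → ℂ)
    (hnc : ¬ ∃ c : Fin r → ℂ, ∃ v : Fin r → ℤ, (∀ i, c i ≠ 0) ∧ v ≠ 0 ∧
        coset c v ⊆ Zset S a) :
    ∀ f : ℂ → (Fin r → ℂ),
      (∀ i, Differentiable ℂ (fun ζ => f ζ i)) →
      (∀ ζ : ℂ, ∀ i, f ζ i ≠ 0) →
      (∀ ζ : ℂ, pa S a (f ζ) = 0) →
      ∀ ζ₁ ζ₂ : ℂ, f ζ₁ = f ζ₂ := by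
  intro f hf hf0 hfp ζ₁ ζ₂
  choose g hg hgf using fun i => exists_entire_log (hf i) fun ζ => hf0 ζ i
  ext j
  rw [← hgf j ζ₁, ← hgf j ζ₂]
  congr 1
  refine is_const_of_deriv_eq_zero (hg j) (fun ζ => ?_) ζ₁ ζ₂
  by_contra hζ
  have hGf : ∀ z, (fun i => Complex.exp (g i (z + ζ))) = f (z + ζ) := fun z => by
    ext i
    exact hgf i _
  obtain ⟨v, hv0, hv⟩ := exists_forall_Qc_eq_zero (S := S) (a := a)
    (G := fun i z => g i (z + ζ)) (fun i => (hg i).comp (differentiable_id.add_const ζ)) (j := j)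
    (by rwa [deriv_comp_add_const, zero_add]) fun z => by rw [hGf, hfp]
  refine hnc ⟨f ζ, v, hf0 ζ, hv0, coset_subset_Zset (hf0 ζ) fun d => ?_⟩
  have := hv d 0
  rwa [hGf, zero_add] at this
end
end

section
/- Let r ≥ 1 and let λ = (λ_1, …, λ_r) ∈ (ℂ*)^r with λ ≠ (1, …, 1). Let f_1, …, f_r ∈ ℂ(T) be nonzero rational functions such that for each i, f_i(0) = 1 and f_i has value λ_i at infinity. Then the union E ⊆ ℂ of the zero–pole sets of f_1, …, f_r has at least rk(λ) + 1 elements. -/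
open scoped BigOperators

noncomputable section

/-- The multiplicative rank of a tuple `λ ∈ (ℂ*)^n`: the least `k` such that all the
`λ_i` lie in the multiplicative subgroup of `ℂ*` generated by some `k` elements
(`rk(1,…,1) = 0`). -/
def mulRank {n : ℕ} (lam : Fin n → ℂˣ) : ℕ :=
  sInf {k : ℕ | ∃ μ : Fin k → ℂˣ, ∀ i, lam i ∈ Subgroup.closure (Set.range μ)}

/-- The zero–pole set of a rational function: the complex roots of its (coprime)
numerator together with those of its denominator. -/
def zeroPoleSet (f : RatFunc ℂ) : Set ℂ :=
  {x : ℂ | Polynomial.eval x f.num = 0 ∨ Polynomial.eval x f.denom = 0}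

/-- `f(0) = 1`: the denominator does not vanish at `0` and numerator and denominator
agree at `0`. -/
def valueOneAtZero (f : RatFunc ℂ) : Prop :=
  Polynomial.eval 0 f.denom ≠ 0 ∧ Polynomial.eval 0 f.num = Polynomial.eval 0 f.denom

/-- `f` has value `lam` at infinity: numerator and denominator have the same degree and
the ratio of their leading coefficients is `lam`. -/
def valueAtInfty (f : RatFunc ℂ) (lam : ℂ) : Prop :=
  f.num.natDegree = f.denom.natDegree ∧
    f.num.leadingCoeff = lam * f.denom.leadingCoeff

/-- A complex polynomial whose roots all lie in the coset `a H` satisfies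
`p(0) = lc(p) (-a)^(deg p) u` for some `u ∈ H`. -/
theorem exists_mem_eval_zero_eq (H : Subgroup ℂˣ) (a : ℂ) (p : Polynomial ℂ)
    (h : ∀ x ∈ p.roots, ∃ u ∈ H, (u : ℂ) * a = x) :
    ∃ u ∈ H, p.eval 0 = p.leadingCoeff * ((-a) ^ p.natDegree * (u : ℂ)) := by
  have prod_eq : ∀ s : Multiset ℂ, (∀ x ∈ s, ∃ u ∈ H, (u : ℂ) * a = x) →
      ∃ u ∈ H, (s.map fun x => 0 - x).prod = (-a) ^ s.card * (u : ℂ) := by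
    intro s
    induction s using Multiset.induction_on with
    | empty => exact fun _ => ⟨1, H.one_mem, by simp⟩
    | cons x s ih =>
      intro hs
      obtain ⟨u, hu, hus⟩ := ih fun y hy => hs y (Multiset.mem_cons_of_mem hy)
      obtain ⟨v, hv, hvx⟩ := hs x (Multiset.mem_cons_self x s)
      refine ⟨v * u, H.mul_mem hv hu, ?_⟩
      rw [Multiset.map_cons, Multiset.prod_cons, hus, Multiset.card_cons, ← hvx]
      push_cast
      ring
  obtain ⟨u, hu, hup⟩ := prod_eq p.roots h
  have hp : p.Splits := IsAlgClosed.splits p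
  refine ⟨u, hu, ?_⟩
  rw [hp.natDegree_eq_card_roots, ← hup]
  exact hp.eval_eq_prod_roots 0

/-- If the zeros and poles of `f` lie in the coset `a H` and `f(0) = 1`, then the value of `f` at
infinity lies in `H`. -/
theorem value_mem_of_zeroPoleSet_subset_coset (H : Subgroup ℂˣ) {a : ℂ} (ha : a ≠ 0)
    {f : RatFunc ℂ} {l : ℂˣ} (h0 : valueOneAtZero f) (hinf : valueAtInfty f (l : ℂ))
    (h : ∀ x ∈ zeroPoleSet f, ∃ u ∈ H, (u : ℂ) * a = x) : l ∈ H := by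
  obtain ⟨u, hu, hup⟩ := exists_mem_eval_zero_eq H a f.num fun x hx =>
    h x (Or.inl (Polynomial.isRoot_of_mem_roots hx))
  obtain ⟨v, hv, hvq⟩ := exists_mem_eval_zero_eq H a f.denom fun x hx =>
    h x (Or.inr (Polynomial.isRoot_of_mem_roots hx))
  rw [h0.2, hvq, hinf.1, hinf.2, (RatFunc.monic_denom f).leadingCoeff] at hup
  have hpow : (-a) ^ f.denom.natDegree ≠ 0 := pow_ne_zero _ (neg_ne_zero.mpr ha)
  have huv : (v : ℂ) = l * u := mul_left_cancel₀ hpow (by linear_combination hup)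
  have hl : l = v * u⁻¹ := eq_mul_inv_of_mul_eq (Units.ext (by simpa using huv.symm))
  exact hl ▸ H.mul_mem hv (H.inv_mem hu)

theorem finite_zeroPoleSet {f : RatFunc ℂ} (hf : f ≠ 0) : (zeroPoleSet f).Finite :=
  (Polynomial.finite_setOfPred_isRoot (RatFunc.num_ne_zero hf)).union
    (Polynomial.finite_setOfPred_isRoot f.denom_ne_zero)

theorem ne_zero_of_mem_zeroPoleSet {f : RatFunc ℂ} (h0 : valueOneAtZero f) {x : ℂ}
    (hx : x ∈ zeroPoleSet f) : x ≠ 0 := by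
  rintro rfl
  rcases hx with hx | hx
  · exact h0.1 (h0.2 ▸ hx)
  · exact h0.1 hx

/-- For `λ ≠ (1,…,1)` and nonzero rational functions `f_i` with `f_i(0) = 1` and value
`λ_i` at infinity, the union of the zero–pole sets of the `f_i` has at least
`rk(λ) + 1` elements. -/
theorem zero_pole_card_lower_bound {r : ℕ} (hr : 1 ≤ r)
    (lam : Fin r → ℂˣ) (hlam : lam ≠ fun _ => 1)
    (f : Fin r → RatFunc ℂ) (hf : ∀ i, f i ≠ 0)
    (h0 : ∀ i, valueOneAtZero (f i))
    (hinf : ∀ i, valueAtInfty (f i) (lam i : ℂ)) :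
    mulRank lam + 1 ≤ (⋃ i, zeroPoleSet (f i)).ncard := by
  set E := ⋃ i, zeroPoleSet (f i)
  have hfin : E.Finite := Set.finite_iUnion fun i => finite_zeroPoleSet (hf i)
  have hmem : ∀ i, ∀ x ∈ zeroPoleSet (f i), x ∈ E := fun i x hx => Set.mem_iUnion_of_mem i hx
  have hne : ∀ x ∈ E, x ≠ 0 := fun x hx => by
    obtain ⟨i, hi⟩ := Set.mem_iUnion.mp hx
    exact ne_zero_of_mem_zeroPoleSet (h0 i) hi
  obtain ⟨a, ha⟩ : E.Nonempty := by
    by_contra hempty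
    refine hlam (funext fun i => Subgroup.mem_bot.mp ?_)
    exact value_mem_of_zeroPoleSet_subset_coset ⊥ one_ne_zero (h0 i) (hinf i)
      fun x hx => (hempty ⟨x, hmem i x hx⟩).elim
  have : Finite ↥(E \ {a}) := hfin.sdiff
  let e : ↥(E \ {a}) ≃ Fin (E \ {a}).ncard := Finite.equivFin _
  let μ : Fin (E \ {a}).ncard → ℂˣ := fun j =>
    Units.mk0 ((e.symm j : ℂ) / a) (div_ne_zero (hne _ (e.symm j).2.1) (hne a ha))
  rw [← Set.ncard_sdiff_singleton_add_one ha hfin]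
  suffices hμ : ∀ i, lam i ∈ Subgroup.closure (Set.range μ) from
    Nat.add_le_add_right (Nat.sInf_le (Set.mem_ofPred.mpr ⟨μ, hμ⟩)) 1
  intro i
  refine value_mem_of_zeroPoleSet_subset_coset _ (hne a ha) (h0 i) (hinf i) fun x hx => ?_
  by_cases hxa : x = a
  · exact ⟨1, Subgroup.one_mem _, by simp [hxa]⟩
  · refine ⟨μ (e ⟨x, hmem i x hx, hxa⟩), Subgroup.subset_closure ⟨_, rfl⟩, ?_⟩
    simp [μ, hne a ha]
end
end

section
/- Let r ≥ 1 and let λ = (λ_1, …, λ_r) ∈ (ℂ*)^r with λ ≠ (1, …, 1). Then there exist nonzero rational functions f_1, …, f_r ∈ ℂ(T) such that for each i, f_i(0) = 1 and f_i has value λ_i at infinity, and the union of the zero–pole sets of f_1, …, f_r has exactly rk(λ) + 1 elements. -/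
open scoped BigOperators

noncomputable section

theorem prod_zpow_eq_zpow_sum {ι G : Type*} [CommGroup G] (s : Finset ι) (f : ι → ℤ) (a : G) :
    ∏ i ∈ s, a ^ f i = a ^ ∑ i ∈ s, f i := by
  classical
  induction s using Finset.induction_on with
  | empty => simp
  | insert i s hi ih => rw [Finset.prod_insert hi, Finset.sum_insert hi, ih, zpow_add]

open Polynomial in
/-- If `p` and `q` are coprime and `q` is monic, then `p / q` is in reduced form. -/
theorem num_denom_div_of_isCoprime {p q : ℂ[X]} (hpq : IsCoprime p q) (hq : q.Monic) :
    (algebraMap ℂ[X] (RatFunc ℂ) p / algebraMap ℂ[X] (RatFunc ℂ) q).num = p ∧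
      (algebraMap ℂ[X] (RatFunc ℂ) p / algebraMap ℂ[X] (RatFunc ℂ) q).denom = q := by
  classical
  have hgcd : gcd p q = 1 := by
    rw [← normalize_gcd, normalize_eq_one]
    exact (gcd_isUnit_iff p q).2 hpq
  constructor
  · rw [RatFunc.num_div, hgcd]
    simp [hq.leadingCoeff]
  · rw [RatFunc.denom_div p hq.ne_zero, hgcd]
    simp [hq.leadingCoeff]

open Polynomial in
/-- The monic polynomial whose roots are the points of positive multiplicity of a divisor. -/
def posPartPoly (n : ℂˣ →₀ ℤ) : ℂ[X] :=
  ∏ a ∈ n.support, (X - C (a : ℂ)) ^ (n a).toNat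

theorem posPartPoly_monic (n : ℂˣ →₀ ℤ) : (posPartPoly n).Monic :=
  Polynomial.monic_prod_of_monic _ _ fun _ _ => (Polynomial.monic_X_sub_C _).pow _

theorem natDegree_posPartPoly (n : ℂˣ →₀ ℤ) :
    (posPartPoly n).natDegree = ∑ a ∈ n.support, (n a).toNat := by
  rw [posPartPoly, Polynomial.natDegree_prod_of_monic _ _
    fun _ _ => (Polynomial.monic_X_sub_C _).pow _]
  simp

theorem eval_posPartPoly (n : ℂˣ →₀ ℤ) (x : ℂ) :
    (posPartPoly n).eval x = ∏ a ∈ n.support, (x - a) ^ (n a).toNat := by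
  simp [posPartPoly, Polynomial.eval_prod]

theorem eval_posPartPoly_eq_zero_iff (n : ℂˣ →₀ ℤ) (x : ℂ) :
    (posPartPoly n).eval x = 0 ↔ ∃ a : ℂˣ, 0 < n a ∧ (a : ℂ) = x := by
  rw [eval_posPartPoly, Finset.prod_eq_zero_iff]
  constructor
  · rintro ⟨a, -, h⟩
    refine ⟨a, ?_, (sub_eq_zero.1 (eq_zero_of_pow_eq_zero h)).symm⟩
    by_contra hle
    rw [Int.toNat_of_nonpos (not_lt.1 hle), pow_zero] at h
    exact one_ne_zero h
  · rintro ⟨a, ha, rfl⟩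
    refine ⟨a, by simp [ha.ne'], ?_⟩
    rw [sub_self, zero_pow]
    omega

theorem isCoprime_posPartPoly_neg (n : ℂˣ →₀ ℤ) :
    IsCoprime (posPartPoly n) (posPartPoly (-n)) := by
  refine IsCoprime.prod_left fun a _ => IsCoprime.prod_right fun b _ => ?_
  rcases eq_or_ne a b with rfl | hab
  · rcases le_total (n a) 0 with h | h
    · rw [Int.toNat_of_nonpos h, pow_zero]
      exact isCoprime_one_left
    · rw [Int.toNat_of_nonpos (show (-n) a ≤ 0 by simpa using h), pow_zero]
      exact isCoprime_one_right
  · refine IsCoprime.pow (Polynomial.isCoprime_X_sub_C_of_isUnit_sub ?_)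
    exact (sub_ne_zero.2 fun h => hab (Units.ext h)).isUnit

/-- A degree-zero divisor on `ℂ*` and a compatible constant `c` determine a rational function
with value `1` at `0` and `c` at infinity. -/
theorem exists_ratFunc_of_divisor (c : ℂˣ) (n : ℂˣ →₀ ℤ) (hdeg : (n.sum fun _ m => m) = 0)
    (hprod : (n.prod fun a m => a ^ m) = c⁻¹) :
    ∃ f : RatFunc ℂ, f ≠ 0 ∧ valueOneAtZero f ∧ valueAtInfty f c ∧
      zeroPoleSet f = (fun a : ℂˣ => (a : ℂ)) '' (n.support : Set ℂˣ) := by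
  have hcop : IsCoprime (Polynomial.C (c : ℂ) * posPartPoly n) (posPartPoly (-n)) :=
    (isCoprime_mul_unit_left_left (Polynomial.isUnit_C.2 c.isUnit) _ _).2
      (isCoprime_posPartPoly_neg n)
  obtain ⟨hnum, hden⟩ := num_denom_div_of_isCoprime hcop (posPartPoly_monic _)
  have heval : ∀ m : ℂˣ →₀ ℤ, (posPartPoly m).eval 0 ≠ 0 := fun m h => by
    obtain ⟨a, -, ha⟩ := (eval_posPartPoly_eq_zero_iff m 0).1 h
    exact a.ne_zero ha
  generalize algebraMap (Polynomial ℂ) (RatFunc ℂ) (Polynomial.C (c : ℂ) * posPartPoly n) /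
    algebraMap (Polynomial ℂ) (RatFunc ℂ) (posPartPoly (-n)) = f at hnum hden
  refine ⟨f, ?_, ⟨hden ▸ heval _, ?_⟩, ⟨?_, ?_⟩, ?_⟩
  rotate_left
  · rw [hnum, hden, Polynomial.eval_mul, Polynomial.eval_C, eval_posPartPoly, eval_posPartPoly,
      Finsupp.support_neg]
    have key : c * ∏ a ∈ n.support, (-a) ^ (n a).toNat =
        ∏ a ∈ n.support, (-a) ^ ((-n) a).toNat := by
      have h1 : ∏ a ∈ n.support, (-a) ^ (n a) = c⁻¹ := by
        have : ∏ a ∈ n.support, (-1 : ℂˣ) ^ (n a) = 1 := by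
          rw [prod_zpow_eq_zpow_sum]
          rw [show ∑ a ∈ n.support, n a = 0 from hdeg, zpow_zero]
        rw [← hprod, Finsupp.prod, ← one_mul (∏ a ∈ n.support, a ^ n a), ← this,
          ← Finset.prod_mul_distrib]
        exact Finset.prod_congr rfl fun a _ => by rw [← mul_zpow, neg_one_mul]
      have h2 : (∏ a ∈ n.support, (-a) ^ (n a).toNat) =
          (∏ a ∈ n.support, (-a) ^ (n a)) * ∏ a ∈ n.support, (-a) ^ ((-n) a).toNat := by
        rw [← Finset.prod_mul_distrib]
        refine Finset.prod_congr rfl fun a _ => ?_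
        rw [← zpow_natCast, ← zpow_natCast, ← zpow_add, Finsupp.neg_apply]
        congr 1
        omega
      rw [h2, h1, mul_inv_cancel_left]
    simpa using congrArg (fun u : ℂˣ => (u : ℂ)) key
  · rw [hnum, hden, Polynomial.natDegree_C_mul c.ne_zero, natDegree_posPartPoly,
      natDegree_posPartPoly, Finsupp.support_neg]
    have : ∑ a ∈ n.support, (((n a).toNat : ℤ) - (((-n) a).toNat : ℤ)) = 0 := by
      rw [← hdeg]
      refine Finset.sum_congr rfl fun a _ => ?_
      rw [Finsupp.neg_apply]
      lia
    rw [Finset.sum_sub_distrib, sub_eq_zero] at this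
    exact_mod_cast this
  · rw [hnum, hden, (posPartPoly_monic _).leadingCoeff, Polynomial.leadingCoeff_mul,
      (posPartPoly_monic _).leadingCoeff, Polynomial.leadingCoeff_C]
  · ext x
    simp only [zeroPoleSet, Set.mem_ofPred_eq, hnum, hden, Polynomial.eval_mul, Polynomial.eval_C,
      mul_eq_zero, c.ne_zero, false_or, eval_posPartPoly_eq_zero_iff, Set.mem_image,
      Finset.mem_coe, Finsupp.mem_support_iff, Finsupp.neg_apply]
    constructor
    · rintro (⟨a, h, rfl⟩ | ⟨a, h, rfl⟩) <;> exact ⟨a, by omega, rfl⟩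
    · rintro ⟨a, h, rfl⟩
      rcases lt_or_gt_of_ne h with h | h
      · exact Or.inr ⟨a, by omega, rfl⟩
      · exact Or.inl ⟨a, h, rfl⟩
  · intro h
    rw [h, RatFunc.num_zero] at hnum
    exact mul_ne_zero (Polynomial.C_ne_zero.2 c.ne_zero) (posPartPoly_monic n).ne_zero hnum.symm

/-- Every element of the subgroup generated by `S` is the product of a degree-zero divisor
supported on `S ∪ {1}`. -/
theorem exists_divisor_of_mem_closure {G : Type*} [CommGroup G] {S : Set G} {x : G}
    (hx : x ∈ Subgroup.closure S) :
    ∃ n : G →₀ ℤ, (n.support : Set G) ⊆ insert 1 S ∧ (n.sum fun _ m => m) = 0 ∧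
      (n.prod fun a m => a ^ m) = x := by
  classical
  induction hx using Subgroup.closure_induction with
  | mem a ha =>
    refine ⟨Finsupp.single a 1 + -Finsupp.single 1 1, ?_, ?_, ?_⟩
    · intro b hb
      rcases Finset.mem_union.1 (Finsupp.support_add (Finset.mem_coe.1 hb)) with h | h
      · rw [Finset.mem_singleton.1 (Finsupp.support_single_subset h)]
        exact Or.inr ha
      · rw [Finsupp.support_neg] at h
        exact Or.inl (Finset.mem_singleton.1 (Finsupp.support_single_subset h))
    · rw [Finsupp.sum_add_index' (by simp) (by simp), Finsupp.sum_neg_index (by simp)]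
      simp
    · rw [Finsupp.prod_add_index' (by simp) (fun a => zpow_add a),
        Finsupp.prod_neg_index (by simp)]
      simp
  | one => exact ⟨0, by simp, by simp, by simp⟩
  | mul a b _ _ iha ihb =>
    obtain ⟨n, hn, hn0, rfl⟩ := iha
    obtain ⟨m, hm, hm0, rfl⟩ := ihb
    refine ⟨n + m, ?_, ?_, ?_⟩
    · intro c hc
      rcases Finset.mem_union.1 (Finsupp.support_add (Finset.mem_coe.1 hc)) with h | h
      · exact hn h
      · exact hm h
    · rw [Finsupp.sum_add_index' (by simp) (by simp), hn0, hm0, add_zero]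
    · rw [Finsupp.prod_add_index' (by simp) (fun a => zpow_add a)]
  | inv a _ iha =>
    obtain ⟨n, hn, hn0, rfl⟩ := iha
    refine ⟨-n, by rwa [Finsupp.support_neg], ?_, ?_⟩
    · rw [Finsupp.sum_neg_index (by simp)]
      simpa [Finsupp.sum] using hn0
    · rw [Finsupp.prod_neg_index (by simp)]
      simp [Finsupp.prod]

/-- The product of a degree-zero divisor supported on `Z` lies in the subgroup generated by
the quotients by a fixed element. -/
theorem prod_mem_closure_of_degree_zero {G : Type*} [CommGroup G] [DecidableEq G]
    {Z : Finset G} {b : G}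
    {n : G →₀ ℤ} (hn : n.support ⊆ Z) (hdeg : (n.sum fun _ m => m) = 0) :
    (n.prod fun a m => a ^ m) ∈
      Subgroup.closure (Set.range fun a : (Z.erase b : Finset G) => (a : G) / b) := by
  have h : (n.prod fun a m => a ^ m) = ∏ a ∈ n.support, (a / b) ^ n a := by
    simp only [div_zpow, Finset.prod_div_distrib, prod_zpow_eq_zpow_sum]
    rw [show ∑ a ∈ n.support, n a = 0 from hdeg, zpow_zero, div_one, Finsupp.prod]
  rw [h]
  refine Subgroup.prod_mem _ fun a ha => Subgroup.zpow_mem _ ?_ _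
  by_cases hab : a = b
  · rw [hab, div_self']
    exact Subgroup.one_mem _
  · exact Subgroup.subset_closure ⟨⟨a, Finset.mem_erase.2 ⟨hab, hn ha⟩⟩, rfl⟩

theorem mulRank_le_card {r : ℕ} {lam : Fin r → ℂˣ} {ι : Type*} [Fintype ι] (μ : ι → ℂˣ)
    (h : ∀ i, lam i ∈ Subgroup.closure (Set.range μ)) : mulRank lam ≤ Fintype.card ι := by
  refine Nat.sInf_le ⟨μ ∘ (Fintype.equivFin ι).symm, fun i => ?_⟩
  rw [(Fintype.equivFin ι).symm.surjective.range_comp]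
  exact h i

theorem exists_generators_mulRank {r : ℕ} (lam : Fin r → ℂˣ) :
    ∃ μ : Fin (mulRank lam) → ℂˣ, ∀ i, lam i ∈ Subgroup.closure (Set.range μ) :=
  Nat.sInf_mem (s := {k : ℕ | ∃ μ : Fin k → ℂˣ, ∀ i, lam i ∈ Subgroup.closure (Set.range μ)})
    ⟨r, lam, fun i => Subgroup.subset_closure ⟨i, rfl⟩⟩

/-- For `λ ≠ (1,…,1)` there exist nonzero rational functions `f_i` with `f_i(0) = 1`
and value `λ_i` at infinity whose zero–pole sets together have exactly `rk(λ) + 1`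
elements. -/
theorem exists_deformation_with_minimal_zero_pole_set {r : ℕ} (hr : 1 ≤ r)
    (lam : Fin r → ℂˣ) (hlam : lam ≠ fun _ => 1) :
    ∃ f : Fin r → RatFunc ℂ,
      (∀ i, f i ≠ 0) ∧
      (∀ i, valueOneAtZero (f i)) ∧
      (∀ i, valueAtInfty (f i) (lam i : ℂ)) ∧
      (⋃ i, zeroPoleSet (f i)).ncard = mulRank lam + 1 := by
  classical
  obtain ⟨μ, hμ⟩ := exists_generators_mulRank lam
  choose n hsupp hdeg hprod using fun i =>
    exists_divisor_of_mem_closure (Subgroup.inv_mem _ (hμ i))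
  choose f hf0 hfz hfi hfs using fun i =>
    exists_ratFunc_of_divisor (lam i) (n i) (hdeg i) (hprod i)
  refine ⟨f, hf0, hfz, hfi, ?_⟩
  set Z : Finset ℂˣ := Finset.univ.biUnion fun i => (n i).support with hZ
  have hunion : (⋃ i, zeroPoleSet (f i)) = (fun a : ℂˣ => (a : ℂ)) '' (Z : Set ℂˣ) := by
    simp only [hfs, hZ, ← Set.image_iUnion, Finset.coe_biUnion, Finset.coe_univ, Set.mem_univ,
      Set.iUnion_true]
  rw [hunion, Set.ncard_image_of_injective _ Units.val_injective, Set.ncard_coe_finset]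
  apply le_antisymm
  · have hsub : Z ⊆ insert 1 (Finset.univ.image μ) := by
      refine Finset.biUnion_subset.2 fun i _ a ha => ?_
      simpa using hsupp i ha
    calc Z.card ≤ (insert 1 (Finset.univ.image μ)).card := Finset.card_le_card hsub
      _ ≤ (Finset.univ.image μ).card + 1 := Finset.card_insert_le _ _
      _ ≤ mulRank lam + 1 := by
        simpa using (Finset.card_image_le (s := Finset.univ) (f := μ))
  · have hne : Z.Nonempty := by
      by_contra hZe
      refine hlam (funext fun i => ?_)
      have hi : (n i).support = ∅ := Finset.subset_empty.1 <|
        Finset.not_nonempty_iff_eq_empty.1 hZe ▸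
          Finset.subset_biUnion_of_mem (fun i => (n i).support) (Finset.mem_univ i)
      have := hprod i
      rw [Finsupp.prod, hi, Finset.prod_empty] at this
      exact inv_eq_one.1 this.symm
    obtain ⟨b, hb⟩ := hne
    have hle : mulRank lam ≤ (Z.erase b).card := by
      simpa only [Fintype.card_coe] using
        mulRank_le_card (fun a : (Z.erase b : Finset ℂˣ) => (a : ℂˣ) / b) fun i => by
        rw [← inv_mem_iff, ← hprod i]
        exact prod_mem_closure_of_degree_zero
          (Finset.subset_biUnion_of_mem (fun i => (n i).support) (Finset.mem_univ i)) (hdeg i)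
    rw [← Finset.card_erase_add_one hb]
    omega
end
end
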